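/- Let p be a prime, r ≥ 1, and let H be a finite simple graph with no automorphism of order p. Let w be any function assigning to each r-tuple v̄ ∈ V(H)^r a value w(v̄) ∈ Z_p, such that w(v̄) = w(v̄′) whenever (H, v̄) and (H, v̄′) are isomorphic. Then there exist finitely many finite simple graphs with r distinguished vertices (G_1, ū_1), ..., (G_t, ū_t) such that for every v̄ ∈ V(H)^r, Σ_{s=1}^{t} |Hom((G_s, ū_s),(H, v̄))| ≡ w(v̄) (mod p). -/

import Mathlib

attribute [local instance] Classical.propDecidable

/-- The number of homomorphisms from the graph `G` with distinguished vertices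
`ub` to the graph `H` with distinguished vertices `vb`. -/
noncomputable def homCount {VG VH : Type*} [Fintype VG] [Fintype VH]
    (G : SimpleGraph VG) (H : SimpleGraph VH) {r : ℕ}
    (ub : Fin r → VG) (vb : Fin r → VH) : ℕ :=
  Fintype.card {f : VG → VH //
    (∀ a b, G.Adj a b → H.Adj (f a) (f b)) ∧ ∀ i, f (ub i) = vb i}

/-- `H` has an automorphism of order `p`: an automorphism `ρ ≠ id` with `ρ^p = id`. -/
def HasOrderPAut {VH : Type*} (p : ℕ) (H : SimpleGraph VH) : Prop :=
  ∃ ρ : H ≃g H, ρ.toEquiv ≠ Equiv.refl VH ∧ ρ.toEquiv ^ p = 1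

/-- The functions realized by a single graph with distinguished vertices. -/
def genSet {VH : Type*} [Fintype VH] (p r : ℕ) (H : SimpleGraph VH) :
    Set ((Fin r → VH) → ZMod p) :=
  {f | ∃ (n : ℕ) (G : SimpleGraph (Fin n)) (ub : Fin r → Fin n),
    f = fun vb => (homCount G H ub vb : ZMod p)}

lemma homCount_eq {VG VH : Type*} [Fintype VG] [Fintype VH]
    (G : SimpleGraph VG) (H : SimpleGraph VH) {r : ℕ}
    (ub : Fin r → VG) (vb : Fin r → VH) : homCount G H ub vb =
  Nat.card {f : VG → VH //
    (∀ a b, G.Adj a b → H.Adj (f a) (f b)) ∧ ∀ i, f (ub i) = vb i} := by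
  rw [Nat.card_eq_fintype_card]
  rfl

/-- Quotienting by equality constraints. -/
lemma count_mem {VH : Type*} [Fintype VH] (p r : ℕ) (H : SimpleGraph VH)
    {V : Type*} [Fintype V] (E R : V → V → Prop) (u : Fin r → V) :
    (fun x : Fin r → VH => ((Finset.univ.filter (fun y : V → VH =>
      ((∀ a b, R a b → H.Adj (y a) (y b)) ∧ ∀ i, y (u i) = x i) ∧
        ∀ a b, E a b → y a = y b)).card : ZMod p)) ∈
      AddSubmonoid.closure (genSet p r H) := by
  obtain ⟨n, ⟨e⟩⟩ := Finite.exists_equiv_fin (Quot E)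
  let π : V → Fin n := fun a => e (Quot.mk E a)
  have hπE : ∀ a b, E a b → π a = π b := fun a b h => congrArg e (Quot.sound h)
  have hπs : Function.Surjective π := e.surjective.comp Quot.mk_surjective
  have lift : ∀ y : V → VH, (∀ a b, E a b → y a = y b) → ∃ f : Fin n → VH, ∀ a, f (π a) = y a := by
    intro y hy
    refine ⟨fun c => Quot.lift y hy (e.symm c), fun a => ?_⟩
    simp [π]
  by_cases hl : ∃ a b, R a b ∧ π a = π b
  · obtain ⟨a, b, hab, hq⟩ := hl
    convert (AddSubmonoid.closure (genSet p r H)).zero_mem using 1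
    funext x
    rw [Finset.filter_eq_empty_iff.2]
    · simp
    · rintro y - ⟨⟨h1, -⟩, h3⟩
      obtain ⟨f, hf⟩ := lift y h3
      have := h1 a b hab
      rw [← hf a, ← hf b, hq] at this
      exact H.loopless.irrefl _ this
  · apply AddSubmonoid.subset_closure
    let G : SimpleGraph (Fin n) :=
      { Adj := fun c d => ∃ a b, (R a b ∨ R b a) ∧ π a = c ∧ π b = d
        symm := ⟨by
          rintro c d ⟨a, b, h, h1, h2⟩
          exact ⟨b, a, h.symm, h2, h1⟩⟩
        loopless := ⟨by
          rintro c ⟨a, b, h | h, h1, h2⟩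
          · exact hl ⟨a, b, h, h1.trans h2.symm⟩
          · exact hl ⟨b, a, h, h2.trans h1.symm⟩⟩ }
    refine ⟨n, G, fun i => π (u i), ?_⟩
    funext x
    congr 1
    rw [homCount_eq, ← Fintype.card_coe, ← Nat.card_eq_fintype_card]
    symm
    refine Nat.card_eq_of_bijective (fun f => ⟨fun a => f.1 (π a), ?_⟩) ⟨?_, ?_⟩
    · rw [Finset.mem_filter]
      refine ⟨Finset.mem_univ _, ⟨fun a b h => f.2.1 _ _ ⟨a, b, Or.inl h, rfl, rfl⟩, f.2.2⟩,
        fun a b h => congrArg f.1 (hπE a b h)⟩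
    · rintro f g h
      apply Subtype.ext
      funext c
      obtain ⟨a, rfl⟩ := hπs c
      exact congrFun (congrArg Subtype.val h) a
    · rintro ⟨y, hy⟩
      obtain ⟨-, ⟨h1, h2⟩, h3⟩ := Finset.mem_filter.1 hy
      obtain ⟨f, hf⟩ := lift y h3
      refine ⟨⟨f, ?_, fun i => by rw [hf, h2]⟩, ?_⟩
      · rintro c d ⟨a, b, h | h, rfl, rfl⟩
        · rw [hf, hf]; exact h1 _ _ h
        · rw [hf, hf]; exact (h1 _ _ h).symm
      · apply Subtype.ext
        funext a
        exact hf a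

lemma smul_mem_clos {X : Type*} {p : ℕ} (hp : p.Prime) (S : AddSubmonoid (X → ZMod p))
    (c : ZMod p) {f : X → ZMod p} (hf : f ∈ S) : (fun x => c * f x) ∈ S := by
  have : NeZero p := ⟨hp.ne_zero⟩
  convert S.nsmul_mem hf c.val using 1
  funext x
  simp [nsmul_eq_mul]

/-- Inclusion-exclusion over disequality constraints. -/
lemma count_mem' {VH : Type*} [Fintype VH] {p : ℕ} (hp : p.Prime) (r : ℕ) (H : SimpleGraph VH)
    {V : Type*} [Fintype V] (R : V → V → Prop) (u : Fin r → V) (D : Finset (V × V)) :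
    ∀ E : V → V → Prop,
    (fun x : Fin r → VH => ((Finset.univ.filter (fun y : V → VH =>
      (((∀ a b, R a b → H.Adj (y a) (y b)) ∧ ∀ i, y (u i) = x i) ∧
        ∀ a b, E a b → y a = y b) ∧ ∀ d ∈ D, y d.1 ≠ y d.2)).card : ZMod p)) ∈
      AddSubmonoid.closure (genSet p r H) := by
  induction D using Finset.induction_on with
  | empty =>
    intro E
    simpa using count_mem p r H E R u
  | insert d D hd ih =>
    intro E
    have h1 := ih E
    have h2 := smul_mem_clos hp _ (-1) (ih (fun a b => E a b ∨ (a = d.1 ∧ b = d.2)))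
    convert AddSubmonoid.add_mem _ h1 h2 using 1
    funext x
    simp only [Pi.add_apply]
    rw [neg_one_mul, ← sub_eq_add_neg, eq_sub_iff_add_eq, ← Nat.cast_add]
    congr 1
    rw [← Finset.card_filter_add_card_filter_not (fun y : V → VH => y d.1 ≠ y d.2)
      (s := Finset.univ.filter (fun y : V → VH =>
      (((∀ a b, R a b → H.Adj (y a) (y b)) ∧ ∀ i, y (u i) = x i) ∧
        ∀ a b, E a b → y a = y b) ∧ ∀ d ∈ D, y d.1 ≠ y d.2))]
    rw [Finset.filter_filter, Finset.filter_filter]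
    congr 2
    · apply Finset.filter_congr
      intro y _
      rw [Finset.forall_mem_insert]
      tauto
    · ext y
      simp only [Finset.mem_filter, Finset.mem_univ, true_and]
      have : (∀ a b, (E a b ∨ (a = d.1 ∧ b = d.2)) → y a = y b) ↔
          (∀ a b, E a b → y a = y b) ∧ y d.1 = y d.2 := by
        constructor
        · exact fun h => ⟨fun a b hab => h a b (Or.inl hab), h _ _ (Or.inr ⟨rfl, rfl⟩)⟩
        · rintro ⟨h, h'⟩ a b (hab | ⟨rfl, rfl⟩)
          · exact h a b hab
          · exact h'
      rw [this, not_not]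
      tauto

lemma inj_mem {VH : Type*} [Fintype VH] {p : ℕ} (hp : p.Prime) (r : ℕ) (H : SimpleGraph VH)
    (u : Fin r → VH) :
    (fun x : Fin r → VH => ((Finset.univ.filter (fun y : VH → VH =>
      (Function.Injective y ∧ ∀ a b, H.Adj a b → H.Adj (y a) (y b)) ∧
        (fun i => y (u i)) = x)).card : ZMod p)) ∈
      AddSubmonoid.closure (genSet p r H) := by
  convert count_mem' hp r H H.Adj u (Finset.univ.filter fun d => d.1 ≠ d.2)
    (fun _ _ => False) using 5 with x
  rename_i y _
  have : Function.Injective y ↔ ∀ d ∈ (Finset.univ.filter fun d : VH × VH => d.1 ≠ d.2),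
      y d.1 ≠ y d.2 := by
    simp only [Finset.mem_filter, Finset.mem_univ, true_and, Prod.forall]
    exact ⟨fun h a b hab => h.ne hab, fun h a b hab => by
      by_contra hne
      exact h a b hne hab⟩
  rw [this, funext_iff]
  simp only [false_imp_iff, implies_true, and_true]
  tauto

/-- An injective endomorphism of a finite graph is an automorphism. -/
lemma exists_aut {VH : Type*} [Fintype VH] (H : SimpleGraph VH) (y : VH → VH)
    (hi : Function.Injective y) (hy : ∀ a b, H.Adj a b → H.Adj (y a) (y b)) :
    ∃ φ : H ≃g H, ∀ a, φ a = y a := by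
  let g : {d : VH × VH // H.Adj d.1 d.2} → {d : VH × VH // H.Adj d.1 d.2} :=
    fun d => ⟨(y d.1.1, y d.1.2), hy _ _ d.2⟩
  have hg : Function.Injective g := by
    rintro ⟨⟨a, b⟩, h⟩ ⟨⟨c, d⟩, h'⟩ hh
    simp only [g, Subtype.mk.injEq, Prod.mk.injEq] at hh
    obtain ⟨h1, h2⟩ := hh
    have e1 := hi h1
    have e2 := hi h2
    subst e1 e2
    rfl
  have hs := Finite.surjective_of_injective hg
  refine ⟨⟨Equiv.ofBijective y (Finite.injective_iff_bijective.1 hi), ?_⟩, fun a => rfl⟩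
  intro a b
  refine ⟨fun h => ?_, hy a b⟩
  obtain ⟨⟨⟨c, d⟩, hcd⟩, hh⟩ := hs ⟨(y a, y b), h⟩
  replace hh : (y c, y d) = (y a, y b) := congrArg Subtype.val hh
  rw [Prod.mk.injEq] at hh
  obtain ⟨h1, h2⟩ := hh
  have e1 := hi h1
  have e2 := hi h2
  subst e1 e2
  exact hcd

lemma card_ne_zero {VH : Type*} [Fintype VH] {p : ℕ} (hp : p.Prime) (H : SimpleGraph VH)
    (hH : ¬ HasOrderPAut p H) :
    (((Finset.univ.filter (fun y : VH → VH =>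
      Function.Injective y ∧ ∀ a b, H.Adj a b → H.Adj (y a) (y b))).card : ℕ) : ZMod p) ≠ 0 := by
  have := Fact.mk hp
  intro h0
  rw [ZMod.natCast_eq_zero_iff] at h0
  have : Finite (H ≃g H) := Finite.of_injective (fun φ : H ≃g H => (φ : VH → VH))
    DFunLike.coe_injective
  have := Fintype.ofFinite (H ≃g H)
  have hc : Fintype.card (H ≃g H) = (Finset.univ.filter (fun y : VH → VH =>
      Function.Injective y ∧ ∀ a b, H.Adj a b → H.Adj (y a) (y b))).card := by
    rw [← Fintype.card_coe]
    refine Fintype.card_of_bijective (f := fun φ => ⟨fun a => φ a, ?_⟩) ⟨?_, ?_⟩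
    · rw [Finset.mem_filter]
      exact ⟨Finset.mem_univ _, φ.injective, fun a b h => φ.map_rel_iff.2 h⟩
    · intro φ ψ h
      apply DFunLike.coe_injective
      exact congrArg Subtype.val h
    · rintro ⟨y, hy⟩
      obtain ⟨-, h1, h2⟩ := Finset.mem_filter.1 hy
      obtain ⟨φ, hφ⟩ := exists_aut H y h1 h2
      exact ⟨φ, Subtype.ext (funext hφ)⟩
  rw [← hc] at h0
  obtain ⟨ρ, hρ⟩ := exists_prime_orderOf_dvd_card p h0
  have hpow : ∀ k : ℕ, (ρ ^ k).toEquiv = ρ.toEquiv ^ k := by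
    intro k
    induction k with
    | zero => rfl
    | succ k ih => rw [pow_succ, pow_succ, ← ih]; rfl
  refine hH ⟨ρ, ?_, ?_⟩
  · intro h
    have : ρ = 1 := by
      ext a
      exact congrArg (fun e : VH ≃ VH => e a) h
    rw [this, orderOf_one] at hρ
    exact hp.one_lt.ne hρ
  · rw [← hpow, ← hρ, pow_orderOf_eq_one]
    rfl

lemma w_mem {p : ℕ} (hp : p.Prime) {r : ℕ}
    {VH : Type*} [Fintype VH] (H : SimpleGraph VH)
    (hH : ¬ HasOrderPAut p H)
    (w : (Fin r → VH) → ZMod p)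
    (hw : ∀ vb vb' : Fin r → VH,
      (∃ φ : H ≃g H, ∀ i, φ (vb i) = vb' i) → w vb = w vb') :
    w ∈ AddSubmonoid.closure (genSet p r H) := by
  have := Fact.mk hp
  have hne := card_ne_zero hp H hH
  set A := Finset.univ.filter (fun y : VH → VH =>
      Function.Injective y ∧ ∀ a b, H.Adj a b → H.Adj (y a) (y b)) with hA
  have key := smul_mem_clos hp _ ((A.card : ZMod p)⁻¹)
    (AddSubmonoid.sum_mem _ (fun v (_ : v ∈ (Finset.univ : Finset (Fin r → VH))) =>
      smul_mem_clos hp _ (w v) (inj_mem hp r H v)))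
  convert key using 1
  funext x
  rw [Finset.sum_apply, eq_inv_mul_iff_mul_eq₀ hne]
  have h1 : ∀ v : Fin r → VH, w v * ((Finset.univ.filter (fun y : VH → VH =>
      (Function.Injective y ∧ ∀ a b, H.Adj a b → H.Adj (y a) (y b)) ∧
        (fun i => y (v i)) = x)).card : ZMod p) =
      ∑ y ∈ A, if (fun i => y (v i)) = x then w v else 0 := by
    intro v
    rw [← Finset.filter_filter, ← Finset.sum_filter, Finset.sum_const, nsmul_eq_mul, mul_comm]
  rw [Finset.sum_congr rfl (fun v _ => h1 v), Finset.sum_comm]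
  have h2 : ∀ y ∈ A, (∑ v : Fin r → VH, if (fun i => y (v i)) = x then w v else 0) = w x := by
    intro y hy
    obtain ⟨-, hi, hh⟩ := Finset.mem_filter.1 hy
    obtain ⟨φ, hφ⟩ := exists_aut H y hi hh
    rw [Finset.sum_eq_single (fun i => φ.symm (x i))]
    · rw [if_pos]
      · exact hw _ _ ⟨φ, fun i => by simp⟩
      · funext i
        rw [← hφ]; simp
    · intro v _ hv
      rw [if_neg]
      intro hvx
      apply hv
      funext i
      rw [← hvx]
      simp [← hφ]
    · simp
  rw [Finset.sum_congr rfl h2, Finset.sum_const, nsmul_eq_mul]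

theorem stmt7 {p : ℕ} (hp : p.Prime) {r : ℕ} (hr : 1 ≤ r)
    {VH : Type*} [Fintype VH] (H : SimpleGraph VH)
    (hH : ¬ HasOrderPAut p H)
    (w : (Fin r → VH) → ZMod p)
    (hw : ∀ vb vb' : Fin r → VH,
      (∃ φ : H ≃g H, ∀ i, φ (vb i) = vb' i) → w vb = w vb') :
    ∃ (t : ℕ) (n : Fin t → ℕ) (G : ∀ s, SimpleGraph (Fin (n s)))
      (ub : ∀ s, Fin r → Fin (n s)),
      ∀ vb : Fin r → VH,
        ∑ s, (homCount (G s) H (ub s) vb : ZMod p) = w vb := by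
  obtain ⟨l, hl, hsum⟩ := AddSubmonoid.exists_list_of_mem_closure (w_mem hp H hH w hw)
  have hl' : ∀ s : Fin l.length, l[s] ∈ genSet p r H := fun s => hl _ (List.getElem_mem _)
  choose n G ub h using hl'
  refine ⟨l.length, n, G, ub, fun vb => ?_⟩
  rw [← hsum, ← Fin.sum_univ_getElem l, Finset.sum_apply]
  apply Finset.sum_congr rfl
  intro s _
  exact (congrFun (h s) vb).symm
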